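/- For every odd positive integer n, there is no perfect strategy for the 2×n quantum magic rectangle game. That is, there do not exist positive integers d_A, d_B, complex d_A×d_A Hermitian unitary matrices A_{ij} (i ∈ {1,2}, 1 ≤ j ≤ n) commuting within each row and satisfying ∏_{j=1}^n A_{ij} = I for each i, complex d_B×d_B Hermitian unitary matrices B_{ij} commuting within each column and satisfying B_{1j}B_{2j} = −I for each j, and a unit vector ψ ∈ ℂ^{d_A}⊗ℂ^{d_B} such that ⟨ψ, (A_{ij} ⊗ B_{ij}) ψ⟩ = 1 for all i,j. -/

import Mathlib

open Matrix Kronecker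

/-- An `m × n` quantum magic rectangle strategy: Alice's observables `A i j` are Hermitian
unitaries commuting within each row with each row product `I`; Bob's observables `B i j` are
Hermitian unitaries commuting within each column with each column product `-I`; `ψ` is a unit
vector in the (Kronecker) tensor product; and the strategy is perfect:
`⟨ψ, (A i j ⊗ B i j) ψ⟩ = 1` for all cells `(i, j)`. -/
def IsPerfectStrategy {m n : ℕ} {ιA ιB : Type*}
    [Fintype ιA] [DecidableEq ιA] [Fintype ιB] [DecidableEq ιB]
    (A : Fin m → Fin n → Matrix ιA ιA ℂ)
    (B : Fin m → Fin n → Matrix ιB ιB ℂ)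
    (ψ : ιA × ιB → ℂ) : Prop :=
  (∀ i j, (A i j).IsHermitian) ∧
  (∀ i j, A i j * A i j = 1) ∧
  (∀ i j j', A i j * A i j' = A i j' * A i j) ∧
  (∀ i, (List.ofFn fun j => A i j).prod = 1) ∧
  (∀ i j, (B i j).IsHermitian) ∧
  (∀ i j, B i j * B i j = 1) ∧
  (∀ i i' j, B i j * B i' j = B i' j * B i j) ∧
  (∀ j, (List.ofFn fun i => B i j).prod = -1) ∧
  star ψ ⬝ᵥ ψ = 1 ∧
  (∀ i j, star ψ ⬝ᵥ ((A i j ⊗ₖ B i j) *ᵥ ψ) = 1)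

open scoped ComplexOrder in
/-- A Hermitian involution whose expectation in a unit vector `ψ` is `1` fixes `ψ`. -/
theorem mulVec_eq_self_of_expectation_eq_one {ι : Type*} [Fintype ι] [DecidableEq ι]
    {M : Matrix ι ι ℂ} {ψ : ι → ℂ} (hM : M.IsHermitian) (hM2 : M * M = 1)
    (hψ : star ψ ⬝ᵥ ψ = 1) (h : star ψ ⬝ᵥ (M *ᵥ ψ) = 1) : M *ᵥ ψ = ψ := by
  have hstar : star (M *ᵥ ψ) = star ψ ᵥ* M := by rw [star_mulVec, hM.eq]
  rw [← sub_eq_zero, ← dotProduct_star_self_eq_zero, star_sub, sub_dotProduct,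
    dotProduct_sub, dotProduct_sub, hstar, ← dotProduct_mulVec, ← dotProduct_mulVec,
    mulVec_mulVec, hM2, one_mulVec, h, hψ]
  ring

/-- If `X j` acts on `ψ` as `c • Y j`, and every `X j` commutes with every `Y k`, then a product
of the `X j` acts on `ψ` as a power of `c` times the reversed product of the `Y j`. -/
theorem list_prod_mulVec_eq_pow_smul {ι κ : Type*} [Fintype ι] [DecidableEq ι]
    {X Y : κ → Matrix ι ι ℂ} {ψ : ι → ℂ} {c : ℂ} (hXY : ∀ j k, Commute (X j) (Y k))
    (h : ∀ j, X j *ᵥ ψ = c • (Y j *ᵥ ψ)) (l : List κ) :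
    (l.map X).prod *ᵥ ψ = c ^ l.length • ((l.reverse.map Y).prod *ᵥ ψ) := by
  induction l with
  | nil => simp
  | cons a l ih =>
    have hcomm : Commute (X a) (l.reverse.map Y).prod :=
      Commute.list_prod_right _ _ fun y hy => by
        obtain ⟨k, -, rfl⟩ := List.mem_map.1 hy
        exact hXY a k
    rw [List.map_cons, List.prod_cons, ← mulVec_mulVec, ih, mulVec_smul, mulVec_mulVec, hcomm.eq,
      ← mulVec_mulVec, h, mulVec_smul, mulVec_mulVec, smul_smul, List.length_cons, pow_succ,
      List.reverse_cons, List.map_append, List.prod_append, List.map_singleton,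
      List.prod_singleton]

theorem list_prod_map_kronecker_one {α β κ : Type*} [Fintype α] [DecidableEq α] [Fintype β]
    [DecidableEq β] (A : κ → Matrix α α ℂ) (l : List κ) :
    (l.map fun j => A j ⊗ₖ (1 : Matrix β β ℂ)).prod = (l.map A).prod ⊗ₖ 1 := by
  induction l with
  | nil => simp
  | cons a l ih =>
    rw [List.map_cons, List.prod_cons, ih, ← mul_kronecker_mul, one_mul, List.map_cons,
      List.prod_cons]

/-- impossibility for `2 × n`, `n` odd: for every odd positive integer `n`
there is no perfect strategy for the `2 × n` quantum magic rectangle game. -/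
theorem no_perfect_strategy_two_by_odd
    (n : ℕ) (hn : Odd n) (hpos : 0 < n) :
    ¬ ∃ (dA dB : ℕ) (_ : 0 < dA) (_ : 0 < dB)
        (A : Fin 2 → Fin n → Matrix (Fin dA) (Fin dA) ℂ)
        (B : Fin 2 → Fin n → Matrix (Fin dB) (Fin dB) ℂ)
        (ψ : Fin dA × Fin dB → ℂ),
        IsPerfectStrategy A B ψ := by
  rintro ⟨dA, dB, -, -, A, B, ψ, hA, hA2, -, hAprod, hB, hB2, -, hBprod, hψ, hperf⟩
  have hfix : ∀ i j, (A i j ⊗ₖ B i j) *ᵥ ψ = ψ := fun i j =>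
    mulVec_eq_self_of_expectation_eq_one
      (by rw [IsHermitian, conjTranspose_kronecker, (hA i j).eq, (hB i j).eq])
      (by rw [← mul_kronecker_mul, hA2, hB2, one_kronecker_one]) hψ (hperf i j)
  have hswap : ∀ i j, (A i j ⊗ₖ (1 : Matrix (Fin dB) (Fin dB) ℂ)) *ᵥ ψ =
      ((1 : Matrix (Fin dA) (Fin dA) ℂ) ⊗ₖ B i j) *ᵥ ψ := fun i j => by
    conv_rhs => rw [← hfix i j]
    rw [mulVec_mulVec, ← mul_kronecker_mul, one_mul, hB2]
  have hneg : ∀ j, B 1 j = -B 0 j := fun j => by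
    have h : B 0 j * B 1 j = -1 := by simpa using hBprod j
    rw [← one_mul (B 1 j), ← hB2 0 j, mul_assoc, h, mul_neg, mul_one]
  have hrow : ∀ i (c : ℂ), (∀ j, B i j = c • B 0 j) →
      ψ = c ^ n • (((List.finRange n).reverse.map fun j =>
        (1 : Matrix (Fin dA) (Fin dA) ℂ) ⊗ₖ B 0 j).prod *ᵥ ψ) := fun i c hc => by
    have h := list_prod_mulVec_eq_pow_smul (ψ := ψ) (c := c)
      (X := fun j => A i j ⊗ₖ (1 : Matrix (Fin dB) (Fin dB) ℂ))
      (Y := fun j => (1 : Matrix (Fin dA) (Fin dA) ℂ) ⊗ₖ B 0 j)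
      (fun j k => by simp [commute_iff_eq, ← mul_kronecker_mul])
      (fun j => by rw [hswap, hc, kronecker_smul, smul_mulVec]) (List.finRange n)
    rwa [list_prod_map_kronecker_one, ← List.ofFn_eq_map, hAprod, one_kronecker_one, one_mulVec,
      List.length_finRange] at h
  have h0 := hrow 0 1 fun j => (one_smul ℂ _).symm
  have h1 := hrow 1 (-1) fun j => by rw [hneg, neg_one_smul]
  rw [hn.neg_one_pow, neg_one_smul] at h1
  rw [one_pow, one_smul] at h0
  rw [← h0] at h1
  rw [self_eq_neg.1 h1] at hψ
  simp at hψ
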